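/- Let n ≥ 3, let F be the free group on x_1, …, x_n, let w ∈ F be nontrivial, not primitive and not a proper power, and set G = F/⟨⟨w⟩⟩. Suppose that G is residually finite and that every finite-index subgroup of G is a one-relator group. Suppose further that there is a subgroup K ≤ F of rank 2 with w ∈ K such that, setting P = K/⟨⟨w⟩⟩_K (the quotient of K by the normal closure of w in K), the canonical homomorphism P → G is injective and P is not a free group. Then P is isomorphic to a solvable Baumslag–Solitar group B(1,m) = ⟨a, b | a b a^{-1} b^{-m}⟩ for some integer m. -/

import Mathlib

/-- A group is a one-relator group if it admits a presentation with finitely many generators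
and a single relator. -/
def IsOneRelatorGroup (G : Type*) [Group G] : Prop :=
  ∃ (m : ℕ) (r : FreeGroup (Fin m)),
    Nonempty (G ≃* PresentedGroup ({r} : Set (FreeGroup (Fin m))))

/-- A group is residually finite if every nontrivial element avoids some finite-index normal
subgroup (equivalently, has nontrivial image in some finite quotient). -/
def ResiduallyFinite (G : Type*) [Group G] : Prop :=
  ∀ g : G, g ≠ 1 → ∃ N : Subgroup G, N.Normal ∧ N.FiniteIndex ∧ g ∉ N

/-- The relator `a b a⁻¹ b^{-m}` of the Baumslag–Solitar group `B(1,m)`, with `a = of true`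
and `b = of false`. -/
def bsRelator (m : ℤ) : FreeGroup Bool :=
  FreeGroup.of true * FreeGroup.of false * (FreeGroup.of true)⁻¹ * FreeGroup.of false ^ (-m)

/-- The canonical homomorphism `P = K/⟨⟨w⟩⟩_K → G = F/⟨⟨w⟩⟩` induced by the inclusion
`K ≤ F`. -/
noncomputable def canonicalMap (n : ℕ) (w : FreeGroup (Fin n))
    (K : Subgroup (FreeGroup (Fin n))) (hwK : w ∈ K) :
    (↥K ⧸ Subgroup.normalClosure {(⟨w, hwK⟩ : K)}) →*
      (FreeGroup (Fin n) ⧸ Subgroup.normalClosure {w}) :=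
  QuotientGroup.lift _
    ((QuotientGroup.mk' (Subgroup.normalClosure {w})).comp K.subtype)
    (by
      apply Subgroup.normalClosure_le_normal
      intro x hx
      simp only [Set.mem_singleton_iff] at hx
      subst hx
      simp only [SetLike.mem_coe, MonoidHom.mem_ker, MonoidHom.comp_apply,
        Subgroup.coe_subtype, QuotientGroup.mk'_apply]
      rw [QuotientGroup.eq_one_iff]
      exact Subgroup.subset_normalClosure rfl)

/-! ### Cocycles with values in permutation modules -/

/-- Pairs of a permutation `σ` of `X` and a function `f : X → k`, composed as the permutations
`(x, a) ↦ (σ x, f x + a)` of `X × k`. -/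
@[ext]
structure AffinePerm (X k : Type*) where
  /-- the underlying permutation -/
  perm : Equiv.Perm X
  /-- the translation part -/
  shift : X → k

namespace AffinePerm

variable {X k : Type*} [AddCommGroup k]

instance : Mul (AffinePerm X k) :=
  ⟨fun u v => ⟨u.perm * v.perm, fun x => u.shift (v.perm x) + v.shift x⟩⟩

instance : One (AffinePerm X k) := ⟨⟨1, 0⟩⟩

instance : Inv (AffinePerm X k) := ⟨fun u => ⟨u.perm⁻¹, fun x => -u.shift (u.perm⁻¹ x)⟩⟩

@[simp] lemma mul_perm (u v : AffinePerm X k) : (u * v).perm = u.perm * v.perm := rfl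

@[simp] lemma mul_shift (u v : AffinePerm X k) (x : X) :
    (u * v).shift x = u.shift (v.perm x) + v.shift x := rfl

@[simp] lemma one_perm : (1 : AffinePerm X k).perm = 1 := rfl

@[simp] lemma one_shift (x : X) : (1 : AffinePerm X k).shift x = 0 := rfl

@[simp] lemma inv_perm (u : AffinePerm X k) : u⁻¹.perm = u.perm⁻¹ := rfl

@[simp] lemma inv_shift (u : AffinePerm X k) (x : X) :
    u⁻¹.shift x = -u.shift (u.perm⁻¹ x) := rfl

instance : Group (AffinePerm X k) :=
  Group.ofLeftAxioms
    (fun a b c => by ext x <;> simp [add_assoc])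
    (fun a => by ext x <;> simp)
    (fun a => by ext x <;> simp)

/-- Forgetting the translation part. -/
def permHom (X k : Type*) [AddCommGroup k] : AffinePerm X k →* Equiv.Perm X where
  toFun := perm
  map_one' := rfl
  map_mul' _ _ := rfl

/-- The action of `AffinePerm X k` on `X × k`. -/
def toPerm (X k : Type*) [AddCommGroup k] : AffinePerm X k →* Equiv.Perm (X × k) where
  toFun u :=
    { toFun := fun q => (u.perm q.1, u.shift q.1 + q.2)
      invFun := fun q => (u.perm⁻¹ q.1, -u.shift (u.perm⁻¹ q.1) + q.2)
      left_inv := fun q => by simp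
      right_inv := fun q => by simp }
  map_one' := by ext q <;> simp
  map_mul' u v := by ext q <;> simp [add_assoc]

lemma toPerm_apply (u : AffinePerm X k) (q : X × k) :
    toPerm X k u q = (u.perm q.1, u.shift q.1 + q.2) := rfl

end AffinePerm

/-- The `k`-valued cocycles of an action `θ` of `Γ` on `X`. -/
def cocycles (k : Type*) [Field k] {Γ X : Type*} [Group Γ] (θ : Γ →* Equiv.Perm X) :
    Submodule k (Γ → X → k) where
  carrier := {c | ∀ g h x, c (g * h) x = c g (θ h x) + c h x}
  zero_mem' := by intro g h x; simp
  add_mem' := by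
    intro c d hc hd g h x
    simp only [Pi.add_apply, hc g h x, hd g h x]
    abel
  smul_mem' := by
    intro a c hc g h x
    simp only [Pi.smul_apply, hc g h x, smul_add]

/-- The dimension of `Hom(Γ, k)`. -/
noncomputable def bettiOne (k : Type*) [Field k] (Γ : Type*) [Group Γ] : ℕ :=
  Module.finrank k (cocycles k (1 : Γ →* Equiv.Perm Unit))

section Cocycles

variable {k : Type*} [Field k] {Γ E X : Type*} [Group Γ] [Group E]

lemma mem_cocycles {θ : Γ →* Equiv.Perm X} {c : Γ → X → k} :
    c ∈ cocycles k θ ↔ ∀ g h x, c (g * h) x = c g (θ h x) + c h x := Iff.rfl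

lemma cocycle_one {θ : Γ →* Equiv.Perm X} {c : Γ → X → k} (hc : c ∈ cocycles k θ) : c 1 = 0 := by
  ext x
  simpa using hc 1 1 x

/-- The homomorphism to `AffinePerm X k` attached to a cocycle. -/
def cocycleHom {θ : Γ →* Equiv.Perm X} {c : Γ → X → k} (hc : c ∈ cocycles k θ) :
    Γ →* AffinePerm X k where
  toFun g := ⟨θ g, c g⟩
  map_one' := by ext x <;> simp [cocycle_one hc]
  map_mul' g h := by ext x <;> simp [hc g h x]

lemma shift_mem_cocycles {θ : Γ →* Equiv.Perm X} {L : Γ →* AffinePerm X k}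
    (hL : ∀ g, (L g).perm = θ g) : (fun g => (L g).shift) ∈ cocycles k θ := by
  intro g h x
  simp [hL]

/-- Pulling back cocycles along a homomorphism. -/
def pullbackCocycles (k : Type*) [Field k] (π : E →* Γ) (θ : Γ →* Equiv.Perm X) :
    cocycles k θ →ₗ[k] cocycles k (θ.comp π) where
  toFun c := ⟨fun g => c.1 (π g), fun g h x => by simpa using c.2 (π g) (π h) x⟩
  map_add' _ _ := rfl
  map_smul' _ _ := rfl

/-- Evaluating cocycles at a group element. -/
def evalCocycle (k : Type*) [Field k] (θ : Γ →* Equiv.Perm X) (w : Γ) :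
    cocycles k θ →ₗ[k] (X → k) where
  toFun c := c.1 w
  map_add' _ _ := rfl
  map_smul' _ _ := rfl

@[simp] lemma evalCocycle_apply (θ : Γ →* Equiv.Perm X) (w : Γ) (c : cocycles k θ) :
    evalCocycle k θ w c = c.1 w := rfl

lemma pullbackCocycles_injective {π : E →* Γ} (hπ : Function.Surjective π)
    (θ : Γ →* Equiv.Perm X) : Function.Injective (pullbackCocycles k π θ) := by
  intro c d h
  ext g x
  obtain ⟨e, rfl⟩ := hπ g
  exact congrFun (congrFun (congrArg Subtype.val h) e) x

lemma range_pullbackCocycles {π : E →* Γ} (hπ : Function.Surjective π) {w : E}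
    (hker : π.ker = Subgroup.normalClosure {w}) (θ : Γ →* Equiv.Perm X) :
    LinearMap.range (pullbackCocycles k π θ) = LinearMap.ker (evalCocycle k (θ.comp π) w) := by
  have hw : π w = 1 := by
    rw [← MonoidHom.mem_ker, hker]
    exact Subgroup.subset_normalClosure rfl
  ext c
  constructor
  · rintro ⟨d, rfl⟩
    change d.1 (π w) = 0
    rw [hw, cocycle_one d.2]
  · intro hc
    have hle : π.ker ≤ (cocycleHom c.2).ker := by
      rw [hker]
      apply Subgroup.normalClosure_le_normal
      rintro _ rfl
      simp only [SetLike.mem_coe, MonoidHom.mem_ker]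
      ext x
      · simp [cocycleHom, hw]
      · exact congrFun hc x
    set L := π.liftOfSurjective hπ ⟨cocycleHom c.2, hle⟩ with hLdef
    have hL : ∀ e, L (π e) = cocycleHom c.2 e := fun e =>
      π.liftOfRightInverse_comp_apply _ _ ⟨cocycleHom c.2, hle⟩ e
    refine ⟨⟨fun g => (L g).shift, shift_mem_cocycles fun g => ?_⟩, ?_⟩
    · obtain ⟨e, rfl⟩ := hπ g
      rw [hL]
      rfl
    · ext e x
      change (L (π e)).shift x = _
      rw [hL]
      rfl

lemma finrank_cocycles_quotient {π : E →* Γ} (hπ : Function.Surjective π) {w : E}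
    (hker : π.ker = Subgroup.normalClosure {w}) (θ : Γ →* Equiv.Perm X)
    [FiniteDimensional k (cocycles k (θ.comp π))] :
    Module.finrank k (cocycles k θ) +
      Module.finrank k (LinearMap.range (evalCocycle k (θ.comp π) w)) =
      Module.finrank k (cocycles k (θ.comp π)) := by
  rw [← LinearMap.finrank_range_add_finrank_ker (evalCocycle k (θ.comp π) w),
    ← range_pullbackCocycles hπ hker,
    LinearMap.finrank_range_of_inj (pullbackCocycles_injective hπ θ), add_comm]

lemma finiteDimensional_cocycles_of_surjective {π : E →* Γ} (hπ : Function.Surjective π)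
    (θ : Γ →* Equiv.Perm X) [FiniteDimensional k (cocycles k (θ.comp π))] :
    FiniteDimensional k (cocycles k θ) :=
  FiniteDimensional.of_injective _ (pullbackCocycles_injective hπ θ)

/-- Cocycles of a free group are determined freely by their values on a basis. -/
noncomputable def freeCocyclesEquiv {ι : Type*} (b : FreeGroupBasis ι E) (θ : E →* Equiv.Perm X) :
    cocycles k θ ≃ₗ[k] (ι → X → k) :=
  LinearEquiv.ofBijective
    { toFun := fun c i => c.1 (b i)
      map_add' := fun _ _ => rfl
      map_smul' := fun _ _ => rfl }
    (by
      constructor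
      · intro c d h
        have : cocycleHom c.2 = cocycleHom d.2 := b.ext_hom _ _ fun i => by
          ext x
          · rfl
          · exact congrFun (congrFun h i) x
        ext g x
        exact congrFun (congrArg AffinePerm.shift (DFunLike.congr_fun this g)) x
      · intro ξ
        set L := b.lift (fun i => (⟨θ (b i), ξ i⟩ : AffinePerm X k)) with hLdef
        have hb : ∀ i, L (b i) = ⟨θ (b i), ξ i⟩ := fun i => by simp [hLdef]
        have hL : (AffinePerm.permHom X k).comp L = θ := b.ext_hom _ _ fun i => by
          simp only [MonoidHom.comp_apply, hb]
          rfl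
        refine ⟨⟨fun g => (L g).shift,
          shift_mem_cocycles fun g => DFunLike.congr_fun hL g⟩, ?_⟩
        ext i x
        simp [hb])

lemma finiteDimensional_cocycles_free {ι : Type*} [Finite ι] [Finite X] (b : FreeGroupBasis ι E)
    (θ : E →* Equiv.Perm X) : FiniteDimensional k (cocycles k θ) :=
  Module.Finite.equiv (freeCocyclesEquiv b θ).symm

lemma finrank_cocycles_free {ι : Type*} [Finite ι] [Finite X] (b : FreeGroupBasis ι E)
    (θ : E →* Equiv.Perm X) :
    Module.finrank k (cocycles k θ) = Nat.card ι * Nat.card X := by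
  have := Fintype.ofFinite ι
  have := Fintype.ofFinite X
  rw [(freeCocyclesEquiv b θ).finrank_eq, Module.finrank_pi_fintype]
  simp [Nat.card_eq_fintype_card]

lemma finrank_cocycles_comp_equiv (e : E ≃* Γ) (θ : Γ →* Equiv.Perm X) :
    Module.finrank k (cocycles k (θ.comp e.toMonoidHom)) = Module.finrank k (cocycles k θ) := by
  refine (LinearEquiv.ofBijective (pullbackCocycles k e.toMonoidHom θ)
    ⟨pullbackCocycles_injective e.surjective θ, fun c => ?_⟩).finrank_eq.symm
  refine ⟨⟨fun g => c.1 (e.symm g), fun g h x => ?_⟩, ?_⟩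
  · simpa using c.2 (e.symm g) (e.symm h) x
  · ext g x
    change c.1 (e.symm (e g)) x = _
    simp

lemma bettiOne_congr (e : E ≃* Γ) : bettiOne k E = bettiOne k Γ :=
  finrank_cocycles_comp_equiv e (1 : Γ →* Equiv.Perm Unit)

/-! ### Shapiro's lemma -/

/-- Restricting a cocycle to the stabilizer of a point. -/
def restrictStabilizer (k : Type*) [Field k] (θ : Γ →* Equiv.Perm X) (x₀ : X) (A : Subgroup Γ)
    (hA : ∀ g, g ∈ A ↔ θ g x₀ = x₀) :
    cocycles k θ →ₗ[k] cocycles k (1 : A →* Equiv.Perm Unit) where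
  toFun c := ⟨fun a _ => c.1 a x₀, fun a b _ => by
    have := c.2 a b x₀
    rw [(hA b).1 b.2] at this
    simpa using this⟩
  map_add' _ _ := rfl
  map_smul' _ _ := rfl

/-- The coboundary of a function. -/
def coboundary (k : Type*) [Field k] (θ : Γ →* Equiv.Perm X) : (X → k) →ₗ[k] cocycles k θ where
  toFun f := ⟨fun g x => f (θ g x) - f x, fun g h x => by simp⟩
  map_add' f g := by
    ext a x
    simp only [Pi.add_apply, Submodule.coe_add]
    abel
  map_smul' a f := by
    ext g x
    simp [mul_sub]

lemma restrictStabilizer_surjective (θ : Γ →* Equiv.Perm X) (x₀ : X) (A : Subgroup Γ)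
    (hA : ∀ g, g ∈ A ↔ θ g x₀ = x₀) (htrans : ∀ x, ∃ g, θ g x₀ = x) :
    Function.Surjective (restrictStabilizer k θ x₀ A hA) := by
  intro χ
  choose s hs using htrans
  have hmem : ∀ g x, (s (θ g x))⁻¹ * g * s x ∈ A := fun g x => by
    rw [hA]
    simp [hs, Equiv.symm_apply_eq]
  have hmul : ∀ a b : A, χ.1 (a * b) () = χ.1 a () + χ.1 b () := fun a b => by
    simpa using χ.2 a b ()
  refine ⟨⟨fun g x => χ.1 ⟨_, hmem g x⟩ (), fun g h x => ?_⟩, ?_⟩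
  · rw [← hmul]
    refine congrArg (χ.1 · ()) (Subtype.ext ?_)
    simp [mul_assoc]
  · ext a u
    have h₀ : s x₀ ∈ A := (hA _).2 (hs x₀)
    change χ.1 ⟨_, hmem a x₀⟩ () = χ.1 a ()
    have : (⟨_, hmem a x₀⟩ : A) = ⟨s x₀, h₀⟩⁻¹ * a * ⟨s x₀, h₀⟩ := by
      ext
      simp [(hA a).1 a.2]
    rw [this, hmul, hmul, add_right_comm, ← hmul, inv_mul_cancel, cocycle_one χ.2]
    simp

lemma ker_restrictStabilizer (θ : Γ →* Equiv.Perm X) (x₀ : X) (A : Subgroup Γ)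
    (hA : ∀ g, g ∈ A ↔ θ g x₀ = x₀) (htrans : ∀ x, ∃ g, θ g x₀ = x) :
    LinearMap.ker (restrictStabilizer k θ x₀ A hA) = LinearMap.range (coboundary k θ) := by
  ext c
  constructor
  · intro hc
    have hc0 : ∀ a ∈ A, c.1 a x₀ = 0 := fun a ha =>
      congrFun (congrFun (congrArg Subtype.val hc) ⟨a, ha⟩) ()
    choose s hs using htrans
    refine ⟨fun x => c.1 (s x) x₀, ?_⟩
    ext g x
    change c.1 (s (θ g x)) x₀ - c.1 (s x) x₀ = c.1 g x
    have hmem : (s (θ g x))⁻¹ * (g * s x) ∈ A := by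
      rw [hA]
      simp [hs, Equiv.symm_apply_eq]
    have h1 := c.2 (s (θ g x)) ((s (θ g x))⁻¹ * (g * s x)) x₀
    rw [hc0 _ hmem, (hA _).1 hmem, mul_inv_cancel_left, c.2 g (s x) x₀, hs] at h1
    rw [sub_eq_iff_eq_add, h1, add_zero]
  · rintro ⟨f, rfl⟩
    ext a u
    change f (θ a x₀) - f x₀ = 0
    rw [(hA a).1 a.2, sub_self]

lemma finrank_ker_coboundary (θ : Γ →* Equiv.Perm X) (x₀ : X) (htrans : ∀ x, ∃ g, θ g x₀ = x) :
    Module.finrank k (LinearMap.ker (coboundary k θ)) = 1 := by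
  refine finrank_eq_one (R := k) (⟨fun _ => 1, ?_⟩ : LinearMap.ker (coboundary k θ)) ?_ ?_
  · ext g x
    change (1 : k) - 1 = 0
    simp
  · intro h
    have := congrFun (congrArg Subtype.val h) x₀
    simp at this
  · rintro ⟨f, hf⟩
    refine ⟨f x₀, ?_⟩
    ext x
    obtain ⟨g, rfl⟩ := htrans x
    have : f (θ g x₀) - f x₀ = 0 := congrFun (congrFun (congrArg Subtype.val hf) g) x₀
    simp [sub_eq_zero.1 this]

lemma finrank_cocycles_transitive [Finite X] (θ : Γ →* Equiv.Perm X) (x₀ : X) (A : Subgroup Γ)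
    (hA : ∀ g, g ∈ A ↔ θ g x₀ = x₀) (htrans : ∀ x, ∃ g, θ g x₀ = x)
    [FiniteDimensional k (cocycles k θ)] :
    bettiOne k A + Nat.card X = Module.finrank k (cocycles k θ) + 1 := by
  have := Fintype.ofFinite X
  have h1 := LinearMap.finrank_range_add_finrank_ker (restrictStabilizer k θ x₀ A hA)
  have h2 := LinearMap.finrank_range_add_finrank_ker (coboundary k θ)
  rw [finrank_ker_coboundary θ x₀ htrans] at h2
  rw [ker_restrictStabilizer θ x₀ A hA htrans,
    LinearMap.range_eq_top.2 (restrictStabilizer_surjective θ x₀ A hA htrans), finrank_top] at h1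
  rw [Module.finrank_fintype_fun_eq_card, ← Nat.card_eq_fintype_card] at h2
  rw [bettiOne]
  omega

end Cocycles

/-! ### Betti numbers of finite-index subgroups of one-relator groups -/

/-- `Γ` has a presentation with `m` generators and one relator. -/
def HasOneRelator (m : ℕ) (Γ : Type*) [Group Γ] : Prop :=
  ∃ (r : FreeGroup (Fin m)) (π : FreeGroup (Fin m) →* Γ),
    Function.Surjective π ∧ π.ker = Subgroup.normalClosure {r}

section OneRelator

variable {k : Type*} [Field k] {Γ X : Type*} [Group Γ] {m : ℕ}

lemma IsOneRelatorGroup.exists_hasOneRelator (h : IsOneRelatorGroup Γ) :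
    ∃ m, HasOneRelator m Γ := by
  obtain ⟨m, r, ⟨e⟩⟩ := h
  refine ⟨m, r, e.symm.toMonoidHom.comp (PresentedGroup.mk {r}),
    e.symm.surjective.comp (PresentedGroup.mk_surjective {r}), ?_⟩
  ext g
  simp only [MonoidHom.mem_ker, MonoidHom.comp_apply, MulEquiv.coe_toMonoidHom,
    map_eq_one_iff _ e.symm.injective]
  exact PresentedGroup.mk_eq_one_iff

lemma HasOneRelator.finiteDimensional (h : HasOneRelator m Γ) [Finite X]
    (θ : Γ →* Equiv.Perm X) : FiniteDimensional k (cocycles k θ) := by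
  obtain ⟨r, π, hπ, -⟩ := h
  have := finiteDimensional_cocycles_free (k := k) (FreeGroupBasis.ofFreeGroup (Fin m)) (θ.comp π)
  exact finiteDimensional_cocycles_of_surjective hπ θ

lemma HasOneRelator.finrank_cocycles (h : HasOneRelator m Γ) [Finite X]
    (θ : Γ →* Equiv.Perm X) :
    Module.finrank k (cocycles k θ) ≤ m * Nat.card X ∧
      m * Nat.card X ≤ Module.finrank k (cocycles k θ) + Nat.card X := by
  have := Fintype.ofFinite X
  obtain ⟨r, π, hπ, hker⟩ := h
  have := finiteDimensional_cocycles_free (k := k) (FreeGroupBasis.ofFreeGroup (Fin m)) (θ.comp π)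
  have h1 := finrank_cocycles_quotient (k := k) hπ hker θ
  rw [finrank_cocycles_free (FreeGroupBasis.ofFreeGroup (Fin m)), Nat.card_fin] at h1
  have h2 := Submodule.finrank_le (LinearMap.range (evalCocycle k (θ.comp π) r))
  rw [Module.finrank_fintype_fun_eq_card, ← Nat.card_eq_fintype_card] at h2
  omega

lemma HasOneRelator.bettiOne_bounds (h : HasOneRelator m Γ) :
    bettiOne k Γ ≤ m ∧ m ≤ bettiOne k Γ + 1 := by
  simpa [bettiOne] using h.finrank_cocycles (k := k) (1 : Γ →* Equiv.Perm Unit)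

lemma mem_iff_smul_mk_one (A : Subgroup Γ) (g : Γ) :
    g ∈ A ↔ MulAction.toPermHom Γ (Γ ⧸ A) g ((1 : Γ) : Γ ⧸ A) = ((1 : Γ) : Γ ⧸ A) := by
  change g ∈ A ↔ ((g * 1 : Γ) : Γ ⧸ A) = ((1 : Γ) : Γ ⧸ A)
  rw [eq_comm, QuotientGroup.eq]
  simp

lemma exists_smul_mk_one (A : Subgroup Γ) (x : Γ ⧸ A) :
    ∃ g, MulAction.toPermHom Γ (Γ ⧸ A) g ((1 : Γ) : Γ ⧸ A) = x := by
  induction x using QuotientGroup.induction_on with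
  | H g => exact ⟨g, by change ((g * 1 : Γ) : Γ ⧸ A) = g; rw [mul_one]⟩

lemma bettiOne_add_index (A : Subgroup Γ) [A.FiniteIndex]
    [FiniteDimensional k (cocycles k (MulAction.toPermHom Γ (Γ ⧸ A)))] :
    bettiOne k A + A.index =
      Module.finrank k (cocycles k (MulAction.toPermHom Γ (Γ ⧸ A))) + 1 :=
  finrank_cocycles_transitive _ _ A (mem_iff_smul_mk_one A) (exists_smul_mk_one A)

lemma HasOneRelator.bettiOne_subgroup_bounds (h : HasOneRelator m Γ) (A : Subgroup Γ)
    [A.FiniteIndex] :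
    bettiOne k A + A.index ≤ m * A.index + 1 ∧ m * A.index + 1 ≤ bettiOne k A + 2 * A.index := by
  have := h.finiteDimensional (k := k) (MulAction.toPermHom Γ (Γ ⧸ A))
  have h1 := bettiOne_add_index (k := k) A
  have h2 := h.finrank_cocycles (k := k) (MulAction.toPermHom Γ (Γ ⧸ A))
  change _ ≤ m * A.index ∧ m * A.index ≤ _ + A.index at h2
  omega

/-- Comparison of the numbers of generators of one-relator presentations of two finite-index
subgroups: `(a - 2) / [G : H] ≤ (b - 1) / [G : N]`. -/
lemma HasOneRelator.compare {a b : ℕ} {H N : Subgroup Γ} [H.FiniteIndex] [N.FiniteIndex]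
    (hH : HasOneRelator a H) (hN : HasOneRelator b N) :
    a * N.index + H.index ≤ b * H.index + 2 * N.index := by
  have h1 := (hH.bettiOne_subgroup_bounds (k := ℚ) ((H ⊓ N).subgroupOf H)).2
  have h2 := (hN.bettiOne_subgroup_bounds (k := ℚ) ((H ⊓ N).subgroupOf N)).1
  rw [bettiOne_congr (Subgroup.subgroupOfEquivOfLe inf_le_left)] at h1
  rw [bettiOne_congr (Subgroup.subgroupOfEquivOfLe inf_le_right)] at h2
  have e1 : ((H ⊓ N).subgroupOf H).index * H.index = (H ⊓ N).index :=
    Subgroup.relIndex_mul_index inf_le_left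
  have e2 : ((H ⊓ N).subgroupOf N).index * N.index = (H ⊓ N).index :=
    Subgroup.relIndex_mul_index inf_le_right
  have hpos : 0 < (H ⊓ N).index := Nat.pos_of_ne_zero Subgroup.FiniteIndex.index_ne_zero
  generalize ((H ⊓ N).subgroupOf H).index = j at *
  generalize ((H ⊓ N).subgroupOf N).index = j' at *
  generalize H.index = d at *
  generalize N.index = e at *
  generalize (H ⊓ N).index = I at *
  have h3 : a * j + j' ≤ b * j' + 2 * j := by omega
  have h4 : I * (a * e + d) ≤ I * (b * d + 2 * e) := by
    calc I * (a * e + d) = d * e * (a * j) + d * d * j := by rw [← e1]; ring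
      _ = d * e * (a * j + j') := by rw [mul_add, mul_assoc d d j, mul_comm d j, e1, ← e2]; ring
      _ ≤ d * e * (b * j' + 2 * j) := Nat.mul_le_mul_left _ h3
      _ = b * d * (j' * e) + 2 * e * (j * d) := by ring
      _ = I * (b * d + 2 * e) := by rw [e1, e2]; ring
  exact Nat.le_of_mul_le_mul_left h4 hpos

end OneRelator

/-! ### Cyclic covers of one-relator groups -/

section Tower

variable {k : Type*} [Field k] {Γ : Type*} [Group Γ] {m : ℕ}

/-- The action of `Γ` on `ZMod q` by translations through `φ`. -/
def cyclicAction (φ : Γ →* Multiplicative ℤ) (q : ℕ) : Γ →* Equiv.Perm (ZMod q) where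
  toFun g := Equiv.addRight (((φ g).toAdd : ℤ) : ZMod q)
  map_one' := by ext x; simp
  map_mul' g h := by ext x; simp; ring

lemma cyclicAction_apply (φ : Γ →* Multiplicative ℤ) (q : ℕ) (g : Γ) (x : ZMod q) :
    cyclicAction φ q g x = x + (((φ g).toAdd : ℤ) : ZMod q) := rfl

/-- Reduction of `φ` modulo `q`. -/
def cyclicHom (φ : Γ →* Multiplicative ℤ) (q : ℕ) : Γ →* Multiplicative (ZMod q) :=
  (AddMonoidHom.toMultiplicative (Int.castAddHom (ZMod q))).comp φ

/-- The preimage of `qℤ` under `φ`. -/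
def cyclicCover (φ : Γ →* Multiplicative ℤ) (q : ℕ) : Subgroup Γ := (cyclicHom φ q).ker

lemma cyclicHom_surjective {φ : Γ →* Multiplicative ℤ} (hφ : Function.Surjective φ) (q : ℕ) :
    Function.Surjective (cyclicHom φ q) := by
  intro x
  obtain ⟨z, hz⟩ := ZMod.intCast_surjective x.toAdd
  obtain ⟨g, hg⟩ := hφ (Multiplicative.ofAdd z)
  refine ⟨g, ?_⟩
  simp only [cyclicHom, MonoidHom.comp_apply, hg]
  exact hz

lemma index_cyclicCover {φ : Γ →* Multiplicative ℤ} (hφ : Function.Surjective φ) (q : ℕ) :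
    (cyclicCover φ q).index = q := by
  rw [cyclicCover, Subgroup.index_ker, MonoidHom.range_eq_top.2 (cyclicHom_surjective hφ q),
    Subgroup.card_top, ← Nat.card_congr Multiplicative.ofAdd, Nat.card_zmod]

lemma finiteIndex_cyclicCover {φ : Γ →* Multiplicative ℤ} (hφ : Function.Surjective φ) (q : ℕ)
    [NeZero q] : (cyclicCover φ q).FiniteIndex :=
  ⟨by rw [index_cyclicCover hφ]; exact NeZero.ne q⟩

lemma bettiOne_cyclicCover (h : HasOneRelator m Γ) {φ : Γ →* Multiplicative ℤ}
    (hφ : Function.Surjective φ) (q : ℕ) [NeZero q] :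
    bettiOne k (cyclicCover φ q) + q =
      Module.finrank k (cocycles k (cyclicAction φ q)) + 1 := by
  have := h.finiteDimensional (k := k) (cyclicAction φ q)
  have := finrank_cocycles_transitive (k := k) (cyclicAction φ q) 0 (cyclicCover φ q)
    (fun g => by
      rw [cyclicAction_apply, zero_add]
      exact Iff.rfl)
    (fun x => by
      obtain ⟨g, hg⟩ := cyclicHom_surjective hφ q (Multiplicative.ofAdd x)
      exact ⟨g, by rw [cyclicAction_apply, zero_add]; exact hg⟩)
  rwa [Nat.card_zmod] at this

/-- Values of cocycles of a cyclic action at a word are given by Fox derivatives. -/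
lemma exists_fox (k : Type*) [Field k] (Φ : FreeGroup (Fin m) →* Multiplicative ℤ)
    (g : FreeGroup (Fin m)) :
    ∃ α : Fin m → ℤ →₀ k, ∀ (q : ℕ), ∀ c ∈ cocycles k (cyclicAction Φ q), ∀ x,
      c g x = ∑ i, (α i).sum fun j a => a * c (FreeGroup.of i) (x + (j : ZMod q)) := by
  have hinv : ∀ g : FreeGroup (Fin m), (∃ α : Fin m → ℤ →₀ k, ∀ (q : ℕ),
      ∀ c ∈ cocycles k (cyclicAction Φ q), ∀ x,
      c g x = ∑ i, (α i).sum fun j a => a * c (FreeGroup.of i) (x + (j : ZMod q))) →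
      ∃ α : Fin m → ℤ →₀ k, ∀ (q : ℕ), ∀ c ∈ cocycles k (cyclicAction Φ q), ∀ x,
      c g⁻¹ x = ∑ i, (α i).sum fun j a => a * c (FreeGroup.of i) (x + (j : ZMod q)) := by
    rintro g ⟨α, hα⟩
    refine ⟨fun i => -(α i).mapDomain (· - (Φ g).toAdd), fun q c hc x => ?_⟩
    have h1 : c g (x - (((Φ g).toAdd : ℤ) : ZMod q)) + c g⁻¹ x = 0 := by
      have := hc g g⁻¹ x
      rw [mul_inv_cancel, cocycle_one hc, cyclicAction_apply] at this
      simpa [sub_eq_add_neg] using this.symm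
    rw [eq_neg_of_add_eq_zero_right h1, hα q c hc, ← Finset.sum_neg_distrib]
    refine Finset.sum_congr rfl fun i _ => ?_
    rw [Finsupp.sum_neg_index (by simp), Finsupp.sum_mapDomain_index (by simp)
      (by intros; ring)]
    · simp only [Finsupp.sum, neg_mul, Finset.sum_neg_distrib, Int.cast_sub]
      congr 1
      refine Finset.sum_congr rfl fun j _ => ?_
      congr 2
      ring
  induction g using FreeGroup.induction_on with
  | C1 => exact ⟨0, fun q c hc x => by simp [cocycle_one hc]⟩
  | of i =>
    refine ⟨Pi.single i (Finsupp.single 0 1), fun q c hc x => ?_⟩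
    rw [Finset.sum_eq_single i]
    · simp
    · intro j _ hj
      simp [hj]
    · simp
  | inv_of i h => exact hinv _ h
  | mul g h hg hh =>
    obtain ⟨α, hα⟩ := hg
    obtain ⟨β, hβ⟩ := hh
    refine ⟨fun i => (α i).mapDomain ((Φ h).toAdd + ·) + β i, fun q c hc x => ?_⟩
    rw [hc g h x, hα q c hc, hβ q c hc, cyclicAction_apply, ← Finset.sum_add_distrib]
    refine Finset.sum_congr rfl fun i _ => ?_
    rw [Finsupp.sum_add_index' (by simp) (by intros; ring),
      Finsupp.sum_mapDomain_index (by simp) (by intros; ring)]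
    simp [add_assoc]

/-- Convolution by a finitely supported function. -/
def convolution (α : ℤ →₀ k) (q : ℕ) : (ZMod q → k) →ₗ[k] (ZMod q → k) where
  toFun f x := α.sum fun j a => a * f (x + (j : ZMod q))
  map_add' f g := by
    ext x
    simp [Finsupp.sum, mul_add, Finset.sum_add_distrib]
  map_smul' a f := by
    ext x
    simp only [Finsupp.sum, Pi.smul_apply, smul_eq_mul, RingHom.id_apply, Finset.mul_sum]
    exact Finset.sum_congr rfl fun j _ => by ring

lemma convolution_apply (α : ℤ →₀ k) (q : ℕ) (f : ZMod q → k) (x : ZMod q) :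
    convolution α q f x = α.sum fun j a => a * f (x + (j : ZMod q)) := rfl

lemma exists_finrank_ker_convolution_le {α : ℤ →₀ k} (hα : α ≠ 0) :
    ∃ C : ℕ, ∀ (q : ℕ) [NeZero q],
      Module.finrank k (LinearMap.ker (convolution α q)) ≤ C := by
  have hne : α.support.Nonempty := Finsupp.support_nonempty_iff.2 hα
  set hi := α.support.max' hne with hhi
  set lo := α.support.min' hne with hlo
  refine ⟨(hi - lo).toNat, fun q _ => ?_⟩
  set R : LinearMap.ker (convolution α q) →ₗ[k] (Fin (hi - lo).toNat → k) :=
    (LinearMap.funLeft k k fun i : Fin (hi - lo).toNat => ((i : ℕ) : ZMod q)) ∘ₗ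
      (LinearMap.ker (convolution α q)).subtype with hR
  have hinj : Function.Injective R := by
    rw [injective_iff_map_eq_zero]
    rintro ⟨f, hf⟩ h0
    have hz : ∀ n : ℕ, f (n : ZMod q) = 0 := by
      intro n
      induction n using Nat.strong_induction_on with
      | _ n ih =>
        by_cases hn : n < (hi - lo).toNat
        · exact congrFun h0 ⟨n, hn⟩
        · have h1 : convolution α q f ((n : ZMod q) - (hi : ZMod q)) = 0 :=
            congrFun hf _
          rw [convolution_apply, Finsupp.sum, Finset.sum_eq_single hi] at h1
          · rw [sub_add_cancel] at h1
            exact (mul_eq_zero.1 h1).resolve_left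
              (Finsupp.mem_support_iff.1 (Finset.max'_mem _ hne))
          · intro j hj hjne
            have h2 : j ≤ hi := Finset.le_max' _ _ hj
            have h3 : lo ≤ j := Finset.min'_le _ _ hj
            obtain ⟨l, hl⟩ := Int.eq_ofNat_of_zero_le (show 0 ≤ n - hi + j by omega)
            have h4 : (n : ZMod q) - (hi : ZMod q) + (j : ZMod q) = (l : ZMod q) := by
              have := congrArg (Int.cast : ℤ → ZMod q) hl
              simpa using this
            rw [h4, ih l (by omega), mul_zero]
          · intro h
            exact absurd (Finset.max'_mem _ hne) h
    ext x
    obtain ⟨n, rfl⟩ := ZMod.natCast_zmod_surjective x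
    exact hz n
  simpa using LinearMap.finrank_le_finrank_of_injective hinj

/-- Along the cyclic covers, the first Betti number either is that of a free group of rank `m`
or grows with slope at most `m - 2`. -/
lemma HasOneRelator.bettiOne_cyclicCover_dichotomy (h : HasOneRelator m Γ)
    {φ : Γ →* Multiplicative ℤ} (hφ : Function.Surjective φ) :
    (∀ (q : ℕ) [NeZero q], bettiOne k (cyclicCover φ q) + q = m * q + 1) ∨
      ∃ C, ∀ (q : ℕ) [NeZero q], bettiOne k (cyclicCover φ q) + 2 * q ≤ m * q + 1 + C := by
  have hb := fun (q : ℕ) [NeZero q] => bettiOne_cyclicCover (k := k) h hφ q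
  obtain ⟨r, π, hπ, hker⟩ := h
  have hfd := fun (q : ℕ) [NeZero q] =>
    finiteDimensional_cocycles_free (k := k) (FreeGroupBasis.ofFreeGroup (Fin m))
      ((cyclicAction φ q).comp π)
  have hz : ∀ (q : ℕ) [NeZero q], Module.finrank k (cocycles k (cyclicAction φ q)) +
      Module.finrank k (LinearMap.range (evalCocycle k ((cyclicAction φ q).comp π) r)) =
      m * q := by
    intro q _
    have := hfd q
    rw [finrank_cocycles_quotient hπ hker,
      finrank_cocycles_free (FreeGroupBasis.ofFreeGroup (Fin m)), Nat.card_fin, Nat.card_zmod]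
  obtain ⟨α, hα⟩ := exists_fox k (φ.comp π) r
  by_cases h0 : ∀ i, α i = 0
  · left
    intro q _
    have h1 : evalCocycle k ((cyclicAction φ q).comp π) r = 0 := by
      ext c x
      rw [evalCocycle_apply, hα q c.1 c.2 x]
      simp [h0]
    have h2 := hz q
    rw [h1, LinearMap.range_zero, finrank_bot] at h2
    have := hb q
    omega
  · right
    push Not at h0
    obtain ⟨i, hi⟩ := h0
    obtain ⟨C, hC⟩ := exists_finrank_ker_convolution_le hi
    refine ⟨C, fun q _ => ?_⟩
    have h1 : LinearMap.range (convolution (α i) q) ≤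
        LinearMap.range (evalCocycle k ((cyclicAction φ q).comp π) r) := by
      rintro _ ⟨f, rfl⟩
      set e := freeCocyclesEquiv (k := k) (FreeGroupBasis.ofFreeGroup (Fin m))
        ((cyclicAction φ q).comp π)
      set c := e.symm (Pi.single i f) with hc
      have hci : ∀ j, c.1 (FreeGroup.of j) = Pi.single (M := fun _ => ZMod q → k) i f j :=
        fun j => by
          have := congrFun (e.apply_symm_apply (Pi.single i f)) j
          rw [← this]
          rfl
      refine ⟨c, ?_⟩
      ext x
      rw [evalCocycle_apply, hα q c.1 c.2 x, Finset.sum_eq_single i]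
      · rw [hci i, Pi.single_eq_same, convolution_apply]
      · intro j _ hj
        rw [hci j, Pi.single_eq_of_ne hj]
        simp
      · simp
    have h2 := Submodule.finrank_mono h1
    have h3 := LinearMap.finrank_range_add_finrank_ker (convolution (α i) q)
    rw [Module.finrank_fintype_fun_eq_card, ZMod.card] at h3
    have h4 := hC q
    have h5 := hz q
    have h6 := hb q
    omega

end Tower

/-! ### Numbers of generators of finite-index subgroups -/

section Generators

variable {Γ : Type*} [Group Γ]

lemma exists_surjective_of_ne_one {φ : Γ →* Multiplicative ℤ} (hφ : φ ≠ 1) :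
    ∃ ψ : Γ →* Multiplicative ℤ, Function.Surjective ψ ∧ ψ.ker = φ.ker := by
  have hcyc : IsCyclic φ.range := inferInstance
  obtain ⟨g, hg⟩ : ∃ g, φ g ≠ 1 := by
    by_contra! h
    exact hφ (MonoidHom.ext h)
  have hinf : Infinite φ.range := by
    refine Infinite.of_injective (fun n : ℕ => (⟨φ (g ^ n), g ^ n, rfl⟩ : φ.range)) ?_
    intro a b hab
    have h1 : (φ g) ^ a = (φ g) ^ b := by simpa using congrArg Subtype.val hab
    have h2 : (a : ℤ) * (φ g).toAdd = b * (φ g).toAdd := by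
      simpa using congrArg Multiplicative.toAdd h1
    have h3 : (φ g).toAdd ≠ 0 := hg
    exact_mod_cast mul_right_cancel₀ h3 h2
  have e : Multiplicative (ZMod (Nat.card φ.range)) ≃* φ.range := zmodCyclicMulEquiv hcyc
  rw [Nat.card_eq_zero_of_infinite] at e
  replace e : Multiplicative ℤ ≃* φ.range := e
  refine ⟨e.symm.toMonoidHom.comp φ.rangeRestrict,
    e.symm.surjective.comp φ.rangeRestrict_surjective, ?_⟩
  ext x
  simp only [MonoidHom.mem_ker, MonoidHom.comp_apply]
  change e.symm (φ.rangeRestrict x) = 1 ↔ _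
  rw [map_eq_one_iff _ e.symm.injective, ← MonoidHom.mem_ker, MonoidHom.ker_rangeRestrict,
    MonoidHom.mem_ker]

lemma le_of_forall_mul_le {x y C : ℕ} (h : ∀ q : ℕ, q ≠ 0 → q * x ≤ q * y + C) : x ≤ y := by
  by_contra! hlt
  have h1 := h (C + 1) (by omega)
  have h2 : (C + 1) * (y + 1) ≤ (C + 1) * x := Nat.mul_le_mul_left _ hlt
  linarith

/-- If the Betti numbers of the cyclic covers of the finite-index image of `ι` grow with slope
at most `a - 2`, then `(c - 2) / [Γ : H] ≤ (a - 2) / [Γ : ι Δ]`. -/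
lemma HasOneRelator.le_of_cyclicCover_bound {k : Type*} [Field k]
    (hall : ∀ H : Subgroup Γ, H.FiniteIndex → ∃ m, HasOneRelator m H)
    {Δ : Type*} [Group Δ] {ι : Δ →* Γ} (hι : Function.Injective ι) [ι.range.FiniteIndex]
    {φ : Δ →* Multiplicative ℤ} (hφ : Function.Surjective φ) {a C : ℕ}
    (hC : ∀ (q : ℕ) [NeZero q], bettiOne k (cyclicCover φ q) + 2 * q ≤ a * q + 1 + C)
    {c : ℕ} {H : Subgroup Γ} [H.FiniteIndex] (hH : HasOneRelator c H) :
    c * ι.range.index + 2 * H.index ≤ a * H.index + 2 * ι.range.index := by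
  refine le_of_forall_mul_le (C := (C + 1) * H.index) fun q hq => ?_
  have : NeZero q := ⟨hq⟩
  have hidx : ((cyclicCover φ q).map ι).index = q * ι.range.index := by
    rw [Subgroup.index_map_of_injective _ hι, index_cyclicCover hφ]
  have hfin : ((cyclicCover φ q).map ι).FiniteIndex :=
    ⟨by rw [hidx]; exact mul_ne_zero hq Subgroup.FiniteIndex.index_ne_zero⟩
  obtain ⟨b, hb⟩ := hall _ hfin
  have h1 := hH.compare hb
  have h2 := (hb.bettiOne_bounds (k := k)).2
  rw [← bettiOne_congr ((cyclicCover φ q).equivMapOfInjective ι hι)] at h2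
  have h3 := hC q
  rw [hidx] at h1
  have h4 : b + 2 * q ≤ a * q + (C + 1) + 1 := by omega
  have h5 : (b + 2 * q) * H.index ≤ (a * q + (C + 1) + 1) * H.index :=
    Nat.mul_le_mul_right _ h4
  nlinarith

lemma bettiOne_cyclicCover_one {k : Type*} [Field k] (φ : Γ →* Multiplicative ℤ) :
    bettiOne k (cyclicCover φ 1) = bettiOne k Γ := by
  have h : cyclicCover φ 1 = ⊤ := by
    ext g
    simp only [cyclicCover, MonoidHom.mem_ker, Subgroup.mem_top, iff_true]
    exact Subsingleton.elim (α := ZMod 1) _ _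
  rw [h]
  exact bettiOne_congr Subgroup.topEquiv

lemma restrict_ne_one {φ : Γ →* Multiplicative ℤ} (hφ : Function.Surjective φ) (A : Subgroup Γ)
    [A.FiniteIndex] : φ.comp A.subtype ≠ 1 := by
  intro h
  obtain ⟨g, hg⟩ := hφ (Multiplicative.ofAdd 1)
  have h1 : g ^ A.index.factorial ∈ A := by
    obtain ⟨n, hn, hle, hmem⟩ := A.exists_pow_mem_of_index_ne_zero
      Subgroup.FiniteIndex.index_ne_zero g
    obtain ⟨t, ht⟩ := Nat.dvd_factorial hn hle
    rw [ht, pow_mul]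
    exact A.pow_mem hmem t
  have h2 : φ (g ^ A.index.factorial) = 1 := DFunLike.congr_fun h ⟨_, h1⟩
  rw [map_pow, hg, ← ofAdd_nsmul, ofAdd_eq_one] at h2
  simp [Nat.factorial_ne_zero] at h2

/-- If all finite-index subgroups of an `n`-generator one-relator group `Γ` are one-relator
groups, then a subgroup of index `d` needs at most `(n - 2) d + 2` generators. -/
theorem HasOneRelator.generators_le {n : ℕ} (hΓ : HasOneRelator n Γ)
    (hall : ∀ H : Subgroup Γ, H.FiniteIndex → ∃ m, HasOneRelator m H)
    {φ : Γ →* Multiplicative ℤ} (hφ : Function.Surjective φ)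
    {k : Type*} [Field k] (A : Subgroup Γ) [A.FiniteIndex]
    (hA : bettiOne k A + A.index ≤ n * A.index)
    {c : ℕ} {H : Subgroup Γ} [H.FiniteIndex] (hH : HasOneRelator c H) :
    c + 2 * H.index ≤ n * H.index + 2 := by
  have hpos : 0 < A.index := Nat.pos_of_ne_zero Subgroup.FiniteIndex.index_ne_zero
  obtain hfree | ⟨C, hC⟩ := hΓ.bettiOne_cyclicCover_dichotomy (k := k) hφ
  · exfalso
    obtain ⟨a, ha⟩ := hall A inferInstance
    have hcov : ∀ (q : ℕ) [NeZero q], ∃ b, HasOneRelator b (cyclicCover φ q) ∧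
        n * q + 1 ≤ b + q := fun q _ => by
      obtain ⟨b, hb⟩ := hall _ (finiteIndex_cyclicCover hφ q)
      have h1 := (hb.bettiOne_bounds (k := k)).1
      have h2 := hfree q
      exact ⟨b, hb, by omega⟩
    have h1 : n * A.index + 1 ≤ a + A.index := by
      refine le_of_forall_mul_le (C := A.index) fun q hq => ?_
      have : NeZero q := ⟨hq⟩
      obtain ⟨b, hb, hbq⟩ := hcov q
      have := finiteIndex_cyclicCover hφ q
      have h2 := hb.compare ha
      rw [index_cyclicCover hφ] at h2
      nlinarith [Nat.mul_le_mul_right A.index hbq]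
    have h2 := (ha.bettiOne_bounds (k := k)).2
    obtain ⟨ψ, hψ, -⟩ := exists_surjective_of_ne_one (restrict_ne_one hφ A)
    obtain hfree' | ⟨C, hC⟩ := ha.bettiOne_cyclicCover_dichotomy (k := k) hψ
    · have h3 := hfree' 1
      rw [bettiOne_cyclicCover_one] at h3
      omega
    · obtain ⟨b, hb, hbq⟩ := hcov (A.index + 1)
      have := finiteIndex_cyclicCover hφ (A.index + 1)
      have : A.subtype.range.FiniteIndex := by rwa [Subgroup.range_subtype]
      have h3 := HasOneRelator.le_of_cyclicCover_bound hall A.subtype_injective hψ hC hb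
      rw [Subgroup.range_subtype, index_cyclicCover hφ] at h3
      have h4 : a ≤ bettiOne k A + 1 := h2
      have h5 : a + A.index ≤ n * A.index + 1 := by omega
      nlinarith [Nat.mul_le_mul_right A.index hbq, Nat.mul_le_mul_right (A.index + 1) h5]
  · have htop : (MonoidHom.id Γ).range = ⊤ := MonoidHom.range_eq_top.2 Function.surjective_id
    have : (MonoidHom.id Γ).range.FiniteIndex := by rw [htop]; infer_instance
    have h := HasOneRelator.le_of_cyclicCover_bound hall (ι := MonoidHom.id Γ)
      Function.injective_id hφ hC hH
    rw [htop, Subgroup.index_top] at h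
    omega

end Generators

/-! ### Detecting a word by cocycles -/

section Detection

variable {α : Type*}

lemma FreeGroup.mk_cons_eq (z : α × Bool) (L : List (α × Bool)) :
    FreeGroup.mk (z :: L) = FreeGroup.mk [z] * FreeGroup.mk L := by
  rw [FreeGroup.mul_mk, List.singleton_append]

/-- The starting point of the positively oriented edge traversed when the letter `z` acts
on `u`. -/
def edgeSource {X : Type*} (θ : FreeGroup α →* Equiv.Perm X) (z : α × Bool) (u : X) : X :=
  if z.2 then u else θ (FreeGroup.mk [z]) u

lemma cocycle_letter {k X : Type*} [Field k] {θ : FreeGroup α →* Equiv.Perm X}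
    {c : FreeGroup α → X → k} (hc : c ∈ cocycles k θ) (z : α × Bool) (u : X) :
    c (FreeGroup.mk [z]) u = 0 ↔ c (FreeGroup.of z.1) (edgeSource θ z u) = 0 := by
  obtain ⟨i, b⟩ := z
  cases b
  · have h : FreeGroup.of i * FreeGroup.mk [(i, false)] = 1 := mul_inv_cancel (FreeGroup.of i)
    have h1 := hc (FreeGroup.of i) (FreeGroup.mk [(i, false)]) u
    rw [h, cocycle_one hc, Pi.zero_apply] at h1
    simp only [edgeSource, Bool.false_eq_true, if_false]
    constructor
    · intro h2
      rw [h2, add_zero] at h1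
      exact h1.symm
    · intro h2
      rw [h2, zero_add] at h1
      exact h1.symm
  · simp only [edgeSource, if_true]
    exact Iff.rfl

lemma letter_eq_of_edgeSource_eq {X : Type*} {θ : FreeGroup α →* Equiv.Perm X} {y z : α × Bool}
    {u v : X} (h1 : z.1 = y.1) (h2 : edgeSource θ z u = edgeSource θ y v) :
    z.2 = y.2 ∧ u = v ∨ z.2 ≠ y.2 ∧ θ (FreeGroup.mk [z]) u = v := by
  obtain ⟨i, b⟩ := y
  obtain ⟨j, b'⟩ := z
  obtain rfl : j = i := h1
  have hinv : θ (FreeGroup.mk [(j, true)]) * θ (FreeGroup.mk [(j, false)]) = 1 := by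
    rw [← map_mul, ← map_one θ]
    exact congrArg θ (mul_inv_cancel (FreeGroup.of j))
  have hinv' : ∀ x, θ (FreeGroup.mk [(j, true)]) (θ (FreeGroup.mk [(j, false)]) x) = x :=
    fun x => by rw [← Equiv.Perm.mul_apply, hinv, Equiv.Perm.one_apply]
  cases b <;> cases b' <;> simp_all [edgeSource]

/-- If `w` is not detected by cocycles with values in finite permutation modules, then the
suffixes of any reduced word are separated by a finite action in which `w` acts trivially. -/
lemma exists_separating_action [DecidableEq α] {w : FreeGroup α}
    (hbad : ∀ (Y : Type) [Finite Y] (θ : FreeGroup α →* Equiv.Perm Y), θ w = 1 →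
      ∀ c ∈ cocycles (ZMod 2) θ, c w = 0)
    (L : List (α × Bool)) (hL : FreeGroup.IsReduced L) :
    ∃ (Y : Type) (_ : Finite Y) (θ : FreeGroup α →* Equiv.Perm Y) (x₀ : Y), θ w = 1 ∧
      ∀ s t, s <:+ L → t <:+ L → θ (FreeGroup.mk s) x₀ = θ (FreeGroup.mk t) x₀ → s = t := by
  classical
  induction L with
  | nil =>
    refine ⟨Unit, inferInstance, 1, (), rfl, fun s t hs ht _ => ?_⟩
    rw [List.suffix_nil.1 hs, List.suffix_nil.1 ht]
  | cons y L ih =>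
    obtain ⟨Y, hY, θ, x₀, hθ, hinj⟩ := ih (List.IsChain.tail hL)
    set v := θ (FreeGroup.mk L) x₀ with hv
    set p := edgeSource θ y v with hp
    set c := (freeCocyclesEquiv (k := ZMod 2) (FreeGroupBasis.ofFreeGroup α) θ).symm
      (Pi.single y.1 (Pi.single p 1)) with hc
    have hcof : ∀ j, c.1 (FreeGroup.of j) =
        Pi.single (M := fun _ => Y → ZMod 2) y.1 (Pi.single p 1) j := fun j => by
      have := congrFun ((freeCocyclesEquiv (k := ZMod 2) (FreeGroupBasis.ofFreeGroup α)
        θ).apply_symm_apply (Pi.single y.1 (Pi.single p 1))) j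
      rw [← this]
      rfl
    have hedge : ∀ z u, c.1 (FreeGroup.mk [z]) u ≠ 0 ↔ z.1 = y.1 ∧ edgeSource θ z u = p := by
      intro z u
      rw [Ne, cocycle_letter c.2, hcof]
      by_cases h1 : z.1 = y.1
      · rw [h1, Pi.single_eq_same]
        by_cases h2 : edgeSource θ z u = p
        · simp [h2]
        · simp [h2]
      · simp [h1]
    have hzero : ∀ s, s <:+ L → c.1 (FreeGroup.mk s) x₀ = 0 := by
      intro s
      induction s with
      | nil =>
        intro _
        exact congrFun (cocycle_one c.2) x₀
      | cons z s ihs =>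
        intro hs
        have hs' : s <:+ L := (List.suffix_cons z s).trans hs
        rw [FreeGroup.mk_cons_eq, c.2, ihs hs', add_zero]
        by_contra hne
        obtain ⟨h1, h2⟩ := (hedge _ _).1 hne
        obtain ⟨-, h3⟩ | ⟨h3, h4⟩ := letter_eq_of_edgeSource_eq h1 h2
        · have := hinj _ _ hs' List.suffix_rfl h3
          subst this
          have := hs.length_le
          simp at this
        · rw [← Equiv.Perm.mul_apply, ← map_mul, ← FreeGroup.mk_cons_eq] at h4
          have := hinj _ _ hs List.suffix_rfl h4
          subst this
          exact h3 ((FreeGroup.isReduced_cons_cons.1 hL).1 h1.symm).symm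
    have hone : c.1 (FreeGroup.mk (y :: L)) x₀ ≠ 0 := by
      rw [FreeGroup.mk_cons_eq, c.2, hzero L List.suffix_rfl, add_zero]
      exact (hedge _ _).2 ⟨rfl, rfl⟩
    refine ⟨Y × ZMod 2, inferInstance,
      (AffinePerm.toPerm Y (ZMod 2)).comp (cocycleHom c.2), (x₀, 0), ?_, ?_⟩
    · ext q : 1
      rw [MonoidHom.comp_apply, AffinePerm.toPerm_apply]
      change (θ w q.1, c.1 w q.1 + q.2) = q
      rw [hθ, hbad Y θ hθ c.1 c.2]
      simp
    · have hval : ∀ s, ((AffinePerm.toPerm Y (ZMod 2)).comp (cocycleHom c.2)) (FreeGroup.mk s)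
          (x₀, 0) = (θ (FreeGroup.mk s) x₀, c.1 (FreeGroup.mk s) x₀) := fun s => by
        rw [MonoidHom.comp_apply, AffinePerm.toPerm_apply]
        exact Prod.ext rfl (add_zero _)
      intro s t hs ht hst
      rw [hval, hval, Prod.mk.injEq] at hst
      obtain rfl | hs := List.suffix_cons_iff.1 hs
      · obtain rfl | ht := List.suffix_cons_iff.1 ht
        · rfl
        · exact absurd (hst.2.trans (hzero t ht)) hone
      · obtain rfl | ht := List.suffix_cons_iff.1 ht
        · exact absurd (hst.2.symm.trans (hzero s hs)) hone
        · exact hinj _ _ hs ht hst.1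

theorem exists_cocycle_apply_ne_zero [DecidableEq α] {w : FreeGroup α} (hw : w ≠ 1) :
    ∃ (Y : Type) (_ : Finite Y) (θ : FreeGroup α →* Equiv.Perm Y), θ w = 1 ∧
      ∃ c ∈ cocycles (ZMod 2) θ, c w ≠ 0 := by
  by_contra! hbad
  obtain ⟨Y, hY, θ, x₀, hθ, hinj⟩ := exists_separating_action
    (fun Y hY θ hθ c hc => hbad Y hY θ hθ c hc) w.toWord FreeGroup.isReduced_toWord
  have h := hinj _ _ List.suffix_rfl List.nil_suffix (by
    rw [FreeGroup.mk_toWord, hθ, ← FreeGroup.one_eq_mk, map_one])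
  exact hw (FreeGroup.toWord_eq_nil_iff.1 h)

/-- A one-relator group with nontrivial relator has a finite-index subgroup whose first Betti
number modulo two is smaller than that of the preimage in the free group. -/
theorem exists_finiteIndex_bettiOne_add_index_le {Γ : Type*} [Group Γ] {n : ℕ}
    {π : FreeGroup (Fin n) →* Γ} (hπ : Function.Surjective π) {w : FreeGroup (Fin n)}
    (hker : π.ker = Subgroup.normalClosure {w}) (hw : w ≠ 1) :
    ∃ A : Subgroup Γ, A.FiniteIndex ∧
      bettiOne (ZMod 2) A + A.index ≤ n * A.index := by
  obtain ⟨Y, hY, θ, hθ, c, hc, hcw⟩ := exists_cocycle_apply_ne_zero hw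
  obtain ⟨y, hy⟩ := Function.ne_iff.1 hcw
  have hle : π.ker ≤ θ.ker := by
    rw [hker]
    apply Subgroup.normalClosure_le_normal
    rintro _ rfl
    exact hθ
  set η := π.liftOfSurjective hπ ⟨θ, hle⟩
  have hη : ∀ e, η (π e) = θ e := fun e => π.liftOfRightInverse_comp_apply _ _ ⟨θ, hle⟩ e
  set A : Subgroup Γ := (MulAction.stabilizer (Equiv.Perm Y) y).comap η with hAdef
  have hA : ∀ g, g ∈ A ↔ η g y = y := fun g => Iff.rfl
  have hfin : A.FiniteIndex := by
    have : ((MulAction.stabilizer (Equiv.Perm Y) y).subgroupOf η.range).FiniteIndex :=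
      inferInstance
    exact ⟨by rw [hAdef, Subgroup.index_comap]; exact this.index_ne_zero⟩
  refine ⟨A, hfin, ?_⟩
  have hfd := finiteDimensional_cocycles_free (k := ZMod 2) (FreeGroupBasis.ofFreeGroup (Fin n))
    ((MulAction.toPermHom Γ (Γ ⧸ A)).comp π)
  have hfd' := finiteDimensional_cocycles_of_surjective hπ (MulAction.toPermHom Γ (Γ ⧸ A))
    (k := ZMod 2)
  have h1 := bettiOne_add_index (k := ZMod 2) A
  have h2 := finrank_cocycles_quotient (k := ZMod 2) hπ hker (MulAction.toPermHom Γ (Γ ⧸ A))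
  rw [finrank_cocycles_free (FreeGroupBasis.ofFreeGroup (Fin n)), Nat.card_fin] at h2
  change _ = n * A.index at h2
  set o : Γ ⧸ A → Y := Quotient.lift (fun g => η g y) (fun a b hab => by
    have h := QuotientGroup.leftRel_apply.1 hab
    rw [hA, map_mul, map_inv, Equiv.Perm.mul_apply, Equiv.Perm.inv_eq_iff_eq] at h
    exact h.symm) with ho
  have hoeq : ∀ g x, o (MulAction.toPermHom Γ (Γ ⧸ A) g x) = η g (o x) := by
    intro g x
    induction x using QuotientGroup.induction_on with
    | H a =>
      change η (g * a) y = η g (η a y)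
      rw [map_mul, Equiv.Perm.mul_apply]
  have h3 : 0 < Module.finrank (ZMod 2) (LinearMap.range
      (evalCocycle (ZMod 2) ((MulAction.toPermHom Γ (Γ ⧸ A)).comp π) w)) := by
    rw [Module.finrank_pos_iff_exists_ne_zero]
    refine ⟨⟨_, ⟨fun g x => c g (o x), fun g h x => ?_⟩, rfl⟩, fun h => hy ?_⟩
    · beta_reduce
      rw [MonoidHom.comp_apply, hoeq, hη]
      exact hc g h (o x)
    · have h4 := congrFun (congrArg Subtype.val h) ((1 : Γ) : Γ ⧸ A)
      have h5 : o ((1 : Γ) : Γ ⧸ A) = y := by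
        change η 1 y = y
        rw [map_one, Equiv.Perm.one_apply]
      simpa [h5] using h4
  omega

end Detection

/-! ### Two-generator subgroups of one-relator groups -/

section Embedding

lemma HasOneRelator.exists_hom_int_ne_one {Γ : Type*} [Group Γ] {m : ℕ} (hm : 2 ≤ m)
    (h : HasOneRelator m Γ) : ∃ φ : Γ →* Multiplicative ℤ, φ ≠ 1 := by
  obtain ⟨r, π, hπ, hker⟩ := h
  suffices ∃ (ψ : FreeGroup (Fin m) →* Multiplicative ℤ) (i : Fin m),
      ψ r = 1 ∧ ψ (FreeGroup.of i) ≠ 1 by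
    obtain ⟨ψ, i, hr, hi⟩ := this
    have hle : π.ker ≤ ψ.ker := by
      rw [hker]
      apply Subgroup.normalClosure_le_normal
      rintro _ rfl
      exact hr
    refine ⟨π.liftOfSurjective hπ ⟨ψ, hle⟩, fun h => hi ?_⟩
    rw [← π.liftOfRightInverse_comp_apply _ (Function.rightInverse_surjInv hπ) ⟨ψ, hle⟩]
    exact DFunLike.congr_fun h _
  set ε : Fin m → FreeGroup (Fin m) →* Multiplicative ℤ := fun i =>
    FreeGroup.lift (Pi.mulSingle i (Multiplicative.ofAdd 1)) with hε
  set i₀ : Fin m := ⟨0, by omega⟩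
  set i₁ : Fin m := ⟨1, by omega⟩
  have hne : i₁ ≠ i₀ := by simp [i₀, i₁]
  have hself : ∀ i, ε i (FreeGroup.of i) = Multiplicative.ofAdd 1 := fun i => by simp [hε]
  have hoff : ε i₀ (FreeGroup.of i₁) = 1 := by simp [hε, hne]
  by_cases h0 : ε i₀ r = 1
  · exact ⟨ε i₀, i₀, h0, by rw [hself]; decide⟩
  · refine ⟨ε i₁ ^ (ε i₀ r).toAdd * ε i₀ ^ (-(ε i₁ r).toAdd), i₁, ?_, ?_⟩
    · apply Multiplicative.toAdd.injective
      simp [mul_comm]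
    · intro h
      have h1 := congrArg Multiplicative.toAdd h
      simp only [MonoidHom.mul_apply, MonoidHom.zpow_apply, hself, hoff] at h1
      simp at h1
      exact h0 h1

lemma range_evalCocycle_le {k : Type*} [Field k] {E D X : Type*} [Group E] [Group D]
    (θ : E →* Equiv.Perm X) (ι : D →* E) (r : D) :
    LinearMap.range (evalCocycle k θ (ι r)) ≤
      LinearMap.range (evalCocycle k (θ.comp ι) r) := by
  rintro _ ⟨c, rfl⟩
  exact ⟨pullbackCocycles k ι θ c, rfl⟩

variable {Γ P : Type*} [Group Γ] [Group P] {n : ℕ}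
  {π : FreeGroup (Fin n) →* Γ} {ρ : FreeGroup (Fin 2) →* P}
  {ι : FreeGroup (Fin 2) →* FreeGroup (Fin n)} {κ : P →* Γ} {r : FreeGroup (Fin 2)}

/-- A two-generator subgroup containing the relator lies in a proper finite-index normal
subgroup if `n ≥ 3`. -/
lemma exists_proper_finiteIndex (hn : 3 ≤ n) (hπ : Function.Surjective π)
    (hπker : π.ker = Subgroup.normalClosure {ι r}) (hρ : Function.Surjective ρ)
    (hρker : ρ.ker = Subgroup.normalClosure {r}) (hcomm : π.comp ι = κ.comp ρ) :
    ∃ H : Subgroup Γ, H.Normal ∧ H.FiniteIndex ∧ κ.range ≤ H ∧ H ≠ ⊤ := by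
  have hE := fun (m : ℕ) (θ : FreeGroup (Fin m) →* Equiv.Perm Unit) =>
    finiteDimensional_cocycles_free (k := ZMod 2) (FreeGroupBasis.ofFreeGroup (Fin m)) θ
  set θ : Γ →* Equiv.Perm Unit := 1
  have hD := hE 2 ((θ.comp κ).comp ρ)
  have hD' := hE n (θ.comp π)
  have hD'' := hE 2 ((θ.comp π).comp ι)
  have h1 := finrank_cocycles_quotient (k := ZMod 2) hπ hπker θ
  have h2 := finrank_cocycles_quotient (k := ZMod 2) hρ hρker (θ.comp κ)
  rw [finrank_cocycles_free (FreeGroupBasis.ofFreeGroup _)] at h1 h2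
  simp only [Nat.card_fin, Nat.card_unique, mul_one] at h1 h2
  have h3 := Submodule.finrank_mono (range_evalCocycle_le (k := ZMod 2) (θ.comp π) ι r)
  rw [MonoidHom.comp_assoc, hcomm, ← MonoidHom.comp_assoc] at h3
  have hfd := finiteDimensional_cocycles_of_surjective (k := ZMod 2) hρ (θ.comp κ)
  obtain ⟨c, hc0, hc⟩ : ∃ c : cocycles (ZMod 2) θ, pullbackCocycles (ZMod 2) κ θ c = 0 ∧
      c ≠ 0 := by
    by_contra! h
    have hinj : Function.Injective (pullbackCocycles (ZMod 2) κ θ) :=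
      (injective_iff_map_eq_zero _).2 h
    have := LinearMap.finrank_le_finrank_of_injective hinj
    omega
  set L := (AffinePerm.toPerm Unit (ZMod 2)).comp (cocycleHom c.2) with hL
  have hmem : ∀ g, g ∈ L.ker ↔ c.1 g () = 0 := by
    intro g
    rw [MonoidHom.mem_ker]
    constructor
    · intro h
      have := congrArg Prod.snd (DFunLike.congr_fun h ((), (0 : ZMod 2)))
      rw [hL, MonoidHom.comp_apply, AffinePerm.toPerm_apply] at this
      simpa [cocycleHom] using this
    · intro h
      ext q : 1
      rw [hL, MonoidHom.comp_apply, AffinePerm.toPerm_apply]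
      change ((), c.1 g () + q.2) = q
      rw [h, zero_add]
  refine ⟨L.ker, inferInstance, inferInstance, ?_, ?_⟩
  · rintro _ ⟨p, rfl⟩
    rw [hmem]
    exact congrFun (congrFun (congrArg Subtype.val hc0) p) ()
  · intro h
    refine hc (Subtype.ext (funext fun g => funext fun u => ?_))
    exact (hmem g).1 (h ▸ Subgroup.mem_top g)

/-- Enlarging a finite-index normal subgroup by an element of prime order in the quotient
produces a finite-index subgroup with first Betti number at least two. -/
lemma HasOneRelator.exists_two_le_bettiOne {m : ℕ} (hP : HasOneRelator m P)
    {φ : P →* Multiplicative ℤ} (hφ : φ ≠ 1) {x : P} (hx : φ x = 1) {Q : Subgroup P} [Q.Normal]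
    [Q.FiniteIndex] (hxQ : x ∉ Q) :
    ∃ (p : ℕ) (_ : Fact p.Prime) (R : Subgroup P), R.FiniteIndex ∧ Q ≤ R ∧
      2 ≤ bettiOne (ZMod p) R := by
  have hord : orderOf (x : P ⧸ Q) ≠ 1 := by
    rwa [Ne, orderOf_eq_one_iff, QuotientGroup.eq_one_iff]
  obtain ⟨p, hp, hdvd⟩ := Nat.exists_prime_and_dvd hord
  have hfact : Fact p.Prime := ⟨hp⟩
  set y : P := x ^ (orderOf (x : P ⧸ Q) / p) with hy
  have hyord : orderOf (y : P ⧸ Q) = p := by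
    rw [hy, QuotientGroup.mk_pow]
    exact orderOf_pow_orderOf_div (orderOf_pos _).ne' hdvd
  set R := (Subgroup.zpowers (y : P ⧸ Q)).comap (QuotientGroup.mk' Q) with hR
  have hQR : Q ≤ R := fun z hz => by
    rw [hR, Subgroup.mem_comap, QuotientGroup.mk'_apply, (QuotientGroup.eq_one_iff z).2 hz]
    exact one_mem _
  have hRfin : R.FiniteIndex := Subgroup.finiteIndex_of_le hQR
  have hyR : y ∈ R := Subgroup.mem_zpowers _
  refine ⟨p, hfact, R, hRfin, hQR, ?_⟩
  obtain ⟨ψ, hψ, hψker⟩ := exists_surjective_of_ne_one hφ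
  obtain ⟨ψ', hψ', hψ'ker⟩ := exists_surjective_of_ne_one (restrict_ne_one hψ R)
  have hψy : ψ' ⟨y, hyR⟩ = 1 := by
    rw [← MonoidHom.mem_ker, hψ'ker, MonoidHom.mem_ker]
    change ψ y = 1
    rw [← MonoidHom.mem_ker, hψker, MonoidHom.mem_ker, hy, map_pow, hx, one_pow]
  have hcard : Nat.card (Subgroup.zpowers (y : P ⧸ Q)) = p := by
    rw [Nat.card_zpowers, hyord]
  have e : Multiplicative (ZMod (Nat.card (Subgroup.zpowers (y : P ⧸ Q)))) ≃*
      Subgroup.zpowers (y : P ⧸ Q) := zmodCyclicMulEquiv inferInstance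
  rw [hcard] at e
  set χ₁ : R →* Multiplicative (ZMod p) :=
    e.symm.toMonoidHom.comp ((QuotientGroup.mk' Q).subgroupComap _) with hχ₁
  set χ₂ : R →* Multiplicative (ZMod p) := cyclicHom ψ' p with hχ₂
  have hχ₁y : χ₁ ⟨y, hyR⟩ ≠ 1 := by
    intro h
    have h1 := (map_eq_one_iff _ e.symm.injective).1 h
    have h2 : (y : P ⧸ Q) = 1 := congrArg Subtype.val h1
    rw [h2, orderOf_one] at hyord
    exact hp.one_lt.ne hyord
  have hχ₂y : χ₂ ⟨y, hyR⟩ = 1 := by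
    rw [hχ₂, cyclicHom, MonoidHom.comp_apply, hψy, map_one]
  obtain ⟨z, hz⟩ := cyclicHom_surjective hψ' p (Multiplicative.ofAdd 1)
  have hcoc : ∀ χ : R →* Multiplicative (ZMod p), (fun g (_ : Unit) => (χ g).toAdd) ∈
      cocycles (ZMod p) (1 : R →* Equiv.Perm Unit) := fun χ g h _ => by simp
  have hfd : FiniteDimensional (ZMod p) (cocycles (ZMod p) (1 : R →* Equiv.Perm Unit)) := by
    have := hP.finiteDimensional (k := ZMod p) (MulAction.toPermHom P (P ⧸ R))
    exact Module.Finite.of_surjective _ (restrictStabilizer_surjective (k := ZMod p)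
      (MulAction.toPermHom P (P ⧸ R)) _ R (mem_iff_smul_mk_one R) (exists_smul_mk_one R))
  have hli : LinearIndependent (ZMod p)
      ![(⟨_, hcoc χ₁⟩ : cocycles (ZMod p) (1 : R →* Equiv.Perm Unit)), ⟨_, hcoc χ₂⟩] := by
    rw [LinearIndependent.pair_iff]
    intro s t hst
    have hval : ∀ g, s * (χ₁ g).toAdd + t * (χ₂ g).toAdd = 0 := fun g =>
      congrFun (congrFun (congrArg Subtype.val hst) g) ()
    have hs : s = 0 := by
      have h := hval ⟨y, hyR⟩
      rw [hχ₂y, toAdd_one, mul_zero, add_zero] at h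
      exact (mul_eq_zero.1 h).resolve_right hχ₁y
    refine ⟨hs, ?_⟩
    have h := hval z
    rw [hχ₂, hz, hs] at h
    simpa using h
  simpa [bettiOne] using hli.fintype_card_le_finrank

/-- The incidence relation between cosets in `P ⧸ R` and in `Γ ⧸ H` induced by right
multiplication by `a`. -/
def cosetRel (κ : P →* Γ) (R : Subgroup P) (H : Subgroup Γ) (a : Γ) (x : P ⧸ R) (u : Γ ⧸ H) :
    Prop :=
  ∃ p : P, (p : P ⧸ R) = x ∧ ((κ p * a : Γ) : Γ ⧸ H) = u

lemma cosetRel_smul (R : Subgroup P) (H : Subgroup Γ) (a : Γ) (q : P) (x : P ⧸ R)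
    (u : Γ ⧸ H) :
    cosetRel κ R H a (MulAction.toPermHom P (P ⧸ R) q x)
      (MulAction.toPermHom Γ (Γ ⧸ H) (κ q) u) ↔ cosetRel κ R H a x u := by
  have key : ∀ (q : P) (x : P ⧸ R) (u : Γ ⧸ H), cosetRel κ R H a x u →
      cosetRel κ R H a (MulAction.toPermHom P (P ⧸ R) q x)
        (MulAction.toPermHom Γ (Γ ⧸ H) (κ q) u) := by
    rintro q _ _ ⟨p, rfl, rfl⟩
    refine ⟨q * p, rfl, ?_⟩
    rw [map_mul, mul_assoc]
    rfl
  refine ⟨fun h => ?_, key q x u⟩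
  have := key q⁻¹ _ _ h
  rwa [← Equiv.Perm.mul_apply, ← Equiv.Perm.mul_apply, ← map_mul, ← map_mul, ← map_mul,
    inv_mul_cancel, map_one, map_one, map_one, Equiv.Perm.one_apply, Equiv.Perm.one_apply] at this

lemma cosetRel_unique {R : Subgroup P} {H : Subgroup Γ} [H.Normal] (hQR : H.comap κ ≤ R)
    {a : Γ} {x x' : P ⧸ R} {u : Γ ⧸ H} (h : cosetRel κ R H a x u) (h' : cosetRel κ R H a x' u) :
    x = x' := by
  obtain ⟨p, rfl, rfl⟩ := h
  obtain ⟨p', rfl, h⟩ := h'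
  rw [QuotientGroup.eq] at h ⊢
  refine inv_mem_iff.1 (hQR ?_)
  rw [Subgroup.mem_comap]
  have h1 := Subgroup.Normal.conj_mem ‹H.Normal› _ h a
  simpa [mul_assoc] using h1

lemma cosetRel_disjoint {R : Subgroup P} {H H' : Subgroup Γ} (hle : H ≤ H') (hκ : κ.range ≤ H')
    {a : Γ} (ha : a ∉ H') {x x' : P ⧸ R} {u : Γ ⧸ H} (h : cosetRel κ R H 1 x u)
    (h' : cosetRel κ R H a x' u) : False := by
  obtain ⟨p, rfl, rfl⟩ := h
  obtain ⟨p', rfl, h⟩ := h'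
  rw [eq_comm, QuotientGroup.eq] at h
  have h1 : κ (p'⁻¹ * p) * ((κ p * 1)⁻¹ * (κ p' * a)) ∈ H' :=
    mul_mem (hκ ⟨_, rfl⟩) (hle h)
  refine ha ?_
  simpa [mul_assoc] using h1

open Classical in
/-- Summation along `cosetRel`. -/
noncomputable def cosetSum (k : Type*) [Field k] (κ : P →* Γ) (R : Subgroup P) (H : Subgroup Γ)
    [Fintype (Γ ⧸ H)] (a : Γ) : (Γ ⧸ H → k) →ₗ[k] (P ⧸ R → k) where
  toFun f x := ∑ u, if cosetRel κ R H a x u then f u else 0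
  map_add' f g := by
    ext x
    simp only [Pi.add_apply, ← Finset.sum_add_distrib]
    exact Finset.sum_congr rfl fun u _ => by split_ifs <;> simp
  map_smul' t f := by
    ext x
    simp [Finset.mul_sum]

open Classical in
lemma cosetSum_apply {k : Type*} [Field k] (R : Subgroup P) (H : Subgroup Γ)
    [Fintype (Γ ⧸ H)] (a : Γ) (f : Γ ⧸ H → k) (x : P ⧸ R) :
    cosetSum k κ R H a f x = ∑ u, if cosetRel κ R H a x u then f u else 0 := rfl

open Classical in
lemma cosetSum_single {k : Type*} [Field k] {R : Subgroup P} {H : Subgroup Γ} [H.Normal]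
    [Fintype (Γ ⧸ H)] (hQR : H.comap κ ≤ R) {a : Γ} {x : P ⧸ R} {u : Γ ⧸ H}
    (h : cosetRel κ R H a x u) :
    cosetSum k κ R H a (Pi.single u 1) = Pi.single x 1 := by
  ext x'
  rw [cosetSum_apply, Finset.sum_eq_single u]
  · by_cases hx : x' = x
    · subst hx
      simp [h]
    · rw [if_neg fun h' => hx (cosetRel_unique hQR h' h), Pi.single_eq_of_ne hx]
  · intro v _ hv
    simp [hv]
  · simp

open Classical in
lemma cosetSum_single_eq_zero {k : Type*} [Field k] {R : Subgroup P} {H : Subgroup Γ}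
    [Fintype (Γ ⧸ H)] {a : Γ} {u : Γ ⧸ H} (h : ∀ x, ¬ cosetRel κ R H a x u) :
    cosetSum k κ R H a (Pi.single u 1) = 0 := by
  ext x
  rw [cosetSum_apply, Pi.zero_apply]
  refine Finset.sum_eq_zero fun v _ => ?_
  split_ifs with hv
  · refine Pi.single_eq_of_ne ?_ _
    rintro rfl
    exact h x hv
  · rfl

lemma cosetSum_evalCocycle {k : Type*} [Field k] {D : Type*} [Group D] (ρ : D →* P)
    (R : Subgroup P) (H : Subgroup Γ) [Fintype (Γ ⧸ H)] (a : Γ) (r : D) (f : Γ ⧸ H → k)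
    (hf : f ∈ LinearMap.range
      (evalCocycle k (((MulAction.toPermHom Γ (Γ ⧸ H)).comp κ).comp ρ) r)) :
    cosetSum k κ R H a f ∈ LinearMap.range
      (evalCocycle k ((MulAction.toPermHom P (P ⧸ R)).comp ρ) r) := by
  classical
  obtain ⟨c, rfl⟩ := hf
  refine ⟨⟨fun g => cosetSum k κ R H a (c.1 g), fun g h x => ?_⟩, rfl⟩
  simp only [cosetSum_apply]
  rw [← Equiv.sum_comp (MulAction.toPermHom Γ (Γ ⧸ H) (κ (ρ h)))
    (fun u => if cosetRel κ R H a (((MulAction.toPermHom P (P ⧸ R)).comp ρ) h x) u then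
      c.1 g u else 0), ← Finset.sum_add_distrib]
  refine Finset.sum_congr rfl fun u _ => ?_
  simp only [MonoidHom.comp_apply, cosetRel_smul, c.2 g h u]
  split_ifs <;> simp

/-- The linear algebra contradicting a large first Betti number of a finite-index subgroup
of `P`. -/
lemma bettiOne_lt_two_of_bettiOne_le {k : Type*} [Field k] (hπ : Function.Surjective π)
    (hπker : π.ker = Subgroup.normalClosure {ι r}) (hρ : Function.Surjective ρ)
    (hρker : ρ.ker = Subgroup.normalClosure {r}) (hcomm : π.comp ι = κ.comp ρ)
    {H H' : Subgroup Γ} [H.Normal] [H.FiniteIndex] (hle : H ≤ H') (hκ : κ.range ≤ H')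
    (hH' : H' ≠ ⊤) (hH : bettiOne k H + 2 * H.index ≤ n * H.index + 2)
    {R : Subgroup P} [R.FiniteIndex] (hQR : H.comap κ ≤ R) : bettiOne k R < 2 := by
  classical
  by_contra! hR
  have := Fintype.ofFinite (Γ ⧸ H)
  have := Fintype.ofFinite (P ⧸ R)
  obtain ⟨a, ha⟩ : ∃ a, a ∉ H' := by
    by_contra! h
    exact hH' ((Subgroup.eq_top_iff' _).2 h)
  set θX := MulAction.toPermHom P (P ⧸ R) with hθX
  set θU := MulAction.toPermHom Γ (Γ ⧸ H) with hθU
  have hX := finiteDimensional_cocycles_free (k := k) (FreeGroupBasis.ofFreeGroup (Fin 2))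
    (θX.comp ρ)
  have hU := finiteDimensional_cocycles_free (k := k) (FreeGroupBasis.ofFreeGroup (Fin n))
    (θU.comp π)
  have hX' := finiteDimensional_cocycles_of_surjective hρ θX (k := k)
  have hU' := finiteDimensional_cocycles_of_surjective hπ θU (k := k)
  have hcardX : Nat.card (P ⧸ R) = R.index := rfl
  have hcardU : Nat.card (Γ ⧸ H) = H.index := rfl
  have h1 := finrank_cocycles_quotient (k := k) hρ hρker θX
  have h2 := finrank_cocycles_quotient (k := k) hπ hπker θU
  rw [finrank_cocycles_free (FreeGroupBasis.ofFreeGroup _), Nat.card_fin] at h1 h2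
  have h3 := bettiOne_add_index (k := k) R
  have h4 := bettiOne_add_index (k := k) H
  rw [← hθX] at h3
  rw [← hθU] at h4
  rw [hcardX] at h1
  rw [hcardU] at h2
  have h5 := Submodule.finrank_mono (range_evalCocycle_le (k := k) (θU.comp π) ι r)
  rw [MonoidHom.comp_assoc, hcomm, ← MonoidHom.comp_assoc] at h5
  have hRpos : 0 < R.index := Nat.pos_of_ne_zero Subgroup.FiniteIndex.index_ne_zero
  have hlt : LinearMap.range (evalCocycle k (θX.comp ρ) r) < ⊤ := by
    refine lt_top_iff_ne_top.2 fun h => ?_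
    rw [h, finrank_top, Module.finrank_fintype_fun_eq_card, ← Nat.card_eq_fintype_card, hcardX] at h1
    omega
  obtain ⟨l, hl0, hl⟩ := Submodule.exists_le_ker_of_lt_top _ hlt
  obtain ⟨x, hx⟩ : ∃ x, l (Pi.single x 1) ≠ 0 := by
    by_contra! h
    refine hl0 (LinearMap.pi_ext' fun x => LinearMap.ext_ring ?_)
    simpa using h x
  obtain ⟨p, rfl⟩ := QuotientGroup.mk_surjective x
  set T : (Γ ⧸ H → k) →ₗ[k] k × k :=
    (l ∘ₗ cosetSum k κ R H 1).prod (l ∘ₗ cosetSum k κ R H a) with hT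
  have hT1 : T (Pi.single ((κ p * 1 : Γ) : Γ ⧸ H) 1) = (l (Pi.single (p : P ⧸ R) 1), 0) := by
    have hrel : cosetRel κ R H 1 (p : P ⧸ R) ((κ p * 1 : Γ) : Γ ⧸ H) := ⟨p, rfl, rfl⟩
    change (l (cosetSum k κ R H 1 _), l (cosetSum k κ R H a _)) = _
    rw [cosetSum_single hQR hrel,
      cosetSum_single_eq_zero fun x' h' => cosetRel_disjoint hle hκ ha hrel h', map_zero]
  have hT2 : T (Pi.single ((κ p * a : Γ) : Γ ⧸ H) 1) = (0, l (Pi.single (p : P ⧸ R) 1)) := by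
    have hrel : cosetRel κ R H a (p : P ⧸ R) ((κ p * a : Γ) : Γ ⧸ H) := ⟨p, rfl, rfl⟩
    change (l (cosetSum k κ R H 1 _), l (cosetSum k κ R H a _)) = _
    rw [cosetSum_single hQR hrel,
      cosetSum_single_eq_zero fun x' h' => cosetRel_disjoint hle hκ ha h' hrel, map_zero]
  have hTsurj : Function.Surjective T := by
    rintro ⟨s, t⟩
    refine ⟨(s / l (Pi.single (p : P ⧸ R) 1)) • Pi.single ((κ p * 1 : Γ) : Γ ⧸ H) 1 +
      (t / l (Pi.single (p : P ⧸ R) 1)) • Pi.single ((κ p * a : Γ) : Γ ⧸ H) 1, ?_⟩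
    rw [map_add, map_smul, map_smul, hT1, hT2]
    simp [hx]
  have h6 := LinearMap.finrank_range_add_finrank_ker T
  rw [LinearMap.range_eq_top.2 hTsurj, finrank_top, Module.finrank_prod, Module.finrank_self,
    Module.finrank_fintype_fun_eq_card, ← Nat.card_eq_fintype_card, hcardU] at h6
  have h7 : LinearMap.range (evalCocycle k ((θU.comp κ).comp ρ) r) ≤ LinearMap.ker T := by
    intro f hf
    exact Prod.ext (hl (cosetSum_evalCocycle ρ R H 1 r f hf))
      (hl (cosetSum_evalCocycle ρ R H a r f hf))
  have h8 := Submodule.finrank_mono h7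
  omega

/-- A two-generator subgroup containing the relator and embedding in a residually finite
one-relator group all of whose finite-index subgroups are one-relator groups is free. -/
theorem isFreeGroup_of_embedding {Γ : Type*} [Group Γ] {P : Type} [Group P] {n : ℕ}
    {π : FreeGroup (Fin n) →* Γ} {ρ : FreeGroup (Fin 2) →* P}
    {ι : FreeGroup (Fin 2) →* FreeGroup (Fin n)} {κ : P →* Γ} {r : FreeGroup (Fin 2)}
    (hn : 3 ≤ n) (hr : ι r ≠ 1) (hπ : Function.Surjective π)
    (hπker : π.ker = Subgroup.normalClosure {ι r}) (hρ : Function.Surjective ρ)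
    (hρker : ρ.ker = Subgroup.normalClosure {r}) (hcomm : π.comp ι = κ.comp ρ)
    (hκ : Function.Injective κ) (hres : ResiduallyFinite Γ)
    (hall : ∀ H : Subgroup Γ, H.FiniteIndex → IsOneRelatorGroup H) : IsFreeGroup P := by
  have hΓ : HasOneRelator n Γ := ⟨_, π, hπ, hπker⟩
  have hP : HasOneRelator 2 P := ⟨r, ρ, hρ, hρker⟩
  have hall' : ∀ H : Subgroup Γ, H.FiniteIndex → ∃ m, HasOneRelator m H :=
    fun H hH => (hall H hH).exists_hasOneRelator
  obtain ⟨φ, hφ⟩ := hP.exists_hom_int_ne_one le_rfl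
  by_cases hinj : Function.Injective φ
  · have hfree : IsFreeGroup (Multiplicative ℤ) :=
      IsFreeGroup.ofMulEquiv (FreeGroup.mulEquivIntOfUnique (α := Unit))
    exact IsFreeGroup.ofMulEquiv (MonoidHom.ofInjective hinj).symm
  · exfalso
    obtain ⟨x, hx, hx1⟩ : ∃ x, φ x = 1 ∧ x ≠ 1 := by
      by_contra! h
      exact hinj ((injective_iff_map_eq_one φ).2 h)
    obtain ⟨H', hH'normal, hH'fin, hκH', hH'top⟩ :=
      exists_proper_finiteIndex hn hπ hπker hρ hρker hcomm
    obtain ⟨N, hNnormal, hNfin, hxN⟩ := hres (κ x) ((map_ne_one_iff κ hκ).2 hx1)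
    have hHcomap : ((N ⊓ H').comap κ).FiniteIndex := by
      have : ((N ⊓ H').subgroupOf κ.range).FiniteIndex := inferInstance
      exact ⟨by rw [Subgroup.index_comap]; exact this.index_ne_zero⟩
    obtain ⟨p, hp, R, hRfin, hQR, hR⟩ := hP.exists_two_le_bettiOne hφ hx
      (Q := (N ⊓ H').comap κ) fun h => hxN h.1
    obtain ⟨Φ, hΦ⟩ := hΓ.exists_hom_int_ne_one (by omega)
    obtain ⟨ψ, hψ, -⟩ := exists_surjective_of_ne_one hΦ
    obtain ⟨A, hAfin, hA⟩ := exists_finiteIndex_bettiOne_add_index_le hπ hπker hr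
    obtain ⟨c, hc⟩ := hall' (N ⊓ H') inferInstance
    have h1 := hΓ.generators_le hall' hψ A hA hc
    have h2 := (hc.bettiOne_bounds (k := ZMod p)).1
    exact absurd (bettiOne_lt_two_of_bettiOne_le (k := ZMod p) hπ hπker hρ hρker hcomm
      inf_le_right hκH' hH'top (by omega) hQR) (by omega)

end Embedding

/-- In the Mel'nikov setting, if `P = K/⟨⟨w⟩⟩_K` embeds in `G = F/⟨⟨w⟩⟩` as a non-free
subgroup, where `K ≤ F` has rank two and contains `w`, then `P` is isomorphic to a solvable
Baumslag–Solitar group `B(1,m)`. -/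
theorem stmt16 (n : ℕ) (hn : 3 ≤ n) (w : FreeGroup (Fin n)) (hw1 : w ≠ 1)
    (hwnotprim : ¬ ∃ (ι : Type) (b : FreeGroupBasis ι (FreeGroup (Fin n))) (i : ι), b i = w)
    (hwnotpow : ¬ ∃ (v : FreeGroup (Fin n)) (r : ℕ), 2 ≤ r ∧ w = v ^ r)
    (hres : ResiduallyFinite (FreeGroup (Fin n) ⧸ Subgroup.normalClosure {w}))
    (hmel : ∀ H : Subgroup (FreeGroup (Fin n) ⧸ Subgroup.normalClosure {w}),
      H.FiniteIndex → IsOneRelatorGroup H)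
    (K : Subgroup (FreeGroup (Fin n))) (hK2 : Nonempty (FreeGroupBasis (Fin 2) K))
    (hwK : w ∈ K)
    (hinj : Function.Injective (canonicalMap n w K hwK))
    (hPnotfree : ¬ IsFreeGroup (↥K ⧸ Subgroup.normalClosure {(⟨w, hwK⟩ : K)})) :
    ∃ m : ℤ,
      Nonempty ((↥K ⧸ Subgroup.normalClosure {(⟨w, hwK⟩ : K)}) ≃*
        PresentedGroup ({bsRelator m} : Set (FreeGroup Bool))) := by
  obtain ⟨b⟩ := hK2
  set e : K ≃* FreeGroup (Fin 2) := b.repr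
  have hr : K.subtype.comp e.symm.toMonoidHom (e ⟨w, hwK⟩) = w := by simp
  refine (hPnotfree (isFreeGroup_of_embedding (ι := K.subtype.comp e.symm.toMonoidHom)
    (r := e ⟨w, hwK⟩) (π := QuotientGroup.mk' (Subgroup.normalClosure {w}))
    (ρ := (QuotientGroup.mk' (Subgroup.normalClosure {(⟨w, hwK⟩ : K)})).comp e.symm.toMonoidHom)
    hn (by rwa [hr]) (QuotientGroup.mk'_surjective _) (by rw [QuotientGroup.ker_mk', hr])
    ((QuotientGroup.mk'_surjective _).comp e.symm.surjective) ?_ ?_ hinj hres hmel)).elim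
  · rw [← MonoidHom.comap_ker, QuotientGroup.ker_mk']
    refine (Subgroup.comap_equiv_eq_map_symm' e.symm _).trans ?_
    rw [Subgroup.map_normalClosure _ _ e.symm.symm.surjective, Set.image_singleton]
    rfl
  · ext i
    rfl
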